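/- Let n ≥ 2, K ≥ 1 and ε > 0 with 1/K > ε/(n+ε). Define f: Bⁿ(0,1) → ℝⁿ by f(x) = (1 + |x|^{ε/(n+ε)} log^{−1/n}(e/|x|), 0, …, 0) and σ(x) = |∇f₁(x)| = |x|^{−n/(n+ε)} ( (ε/(n+ε)) log^{−1/n}(e/|x|) + (1/n) log^{−(n+1)/n}(e/|x|) ). Then f ∈ W^{1,n}(Bⁿ(0,1), ℝⁿ), σ ∈ L^{n+ε}(Bⁿ(0,1)), f satisfies the heterogeneous distortion inequality |Df|ⁿ ≤ K J_f + σⁿ|f|ⁿ a.e. on Bⁿ(0,1), and for every γ > ε/(n+ε) the map f fails to be γ-Hölder continuous at the origin. -/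

import Mathlib

open MeasureTheory Metric Set Filter
open scoped ENNReal Topology

noncomputable section

/-- Euclidean `n`-space. -/
abbrev Eu (n : ℕ) : Type := EuclideanSpace ℝ (Fin n)

/-- `Df` is the weak (distributional) derivative of `f` on the open set `Ω`,
expressed by integration by parts against smooth compactly supported test functions. -/
def IsWeakDerivOn {n : ℕ} {F : Type*} [NormedAddCommGroup F] [NormedSpace ℝ F]
    (Ω : Set (Eu n)) (f : Eu n → F) (Df : Eu n → Eu n →L[ℝ] F) : Prop :=
  ∀ φ : Eu n → ℝ, ContDiff ℝ (⊤ : ℕ∞) φ → HasCompactSupport φ → tsupport φ ⊆ Ω →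
    ∀ v : Eu n, ∫ x in Ω, φ x • Df x v = - ∫ x in Ω, fderiv ℝ φ x v • f x

/-- `f`, with weak derivative `Df`, belongs to the local Sobolev class `W^{1,p}_loc(Ω, F)`:
`Df` is a weak derivative of `f` on `Ω` and `‖f‖^p, ‖Df‖^p` are integrable on every
compact subset of `Ω`. -/
def MemW1Loc {n : ℕ} {F : Type*} [NormedAddCommGroup F] [NormedSpace ℝ F]
    (p : ℝ) (Ω : Set (Eu n)) (f : Eu n → F) (Df : Eu n → Eu n →L[ℝ] F) : Prop :=
  IsWeakDerivOn Ω f Df ∧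
  ∀ Kc : Set (Eu n), Kc ⊆ Ω → IsCompact Kc →
    IntegrableOn (fun x => ‖f x‖ ^ p) Kc volume ∧
    IntegrableOn (fun x => ‖Df x‖ ^ p) Kc volume

/-- The heterogeneous distortion inequality `|Df|^n ≤ K J_f + σ^n |f|^n` a.e. on `Ω`,
where `J_f = det Df`. -/
def HDistortion {n : ℕ} (Ω : Set (Eu n)) (f : Eu n → Eu n)
    (Df : Eu n → Eu n →L[ℝ] Eu n) (K : ℝ) (σ : Eu n → ℝ) : Prop :=
  ∀ᵐ x ∂volume, x ∈ Ω →
    ‖Df x‖ ^ (n : ℝ) ≤ K * (Df x).det + σ x ^ (n : ℝ) * ‖f x‖ ^ (n : ℝ)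



/-- `1/|x|` is integrable on balls in dimension at least two. -/
lemma inv_norm_integrableOn (n : ℕ) (hn : 2 ≤ n) (R : ℝ) :
    IntegrableOn (fun x : Eu n => ‖x‖⁻¹) (ball 0 R) volume := by
  have : Nonempty (Fin n) := ⟨⟨0, by omega⟩⟩
  rw [integrableOn_fun_norm_addHaar volume (f := fun r : ℝ => r⁻¹)]
  have hfin : Module.finrank ℝ (Eu n) = n := by simp
  rw [hfin]
  have h1 : IntegrableOn (fun y : ℝ => y ^ (n - 2)) (Ioo 0 R) volume :=
    ((continuous_pow (n - 2)).integrableOn_Icc (a := 0) (b := R)).mono_set Ioo_subset_Icc_self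
  refine h1.congr_fun (fun y hy => ?_) measurableSet_Ioo
  have hy0 : y ≠ 0 := hy.1.ne'
  obtain ⟨m, rfl⟩ : ∃ m, n = m + 2 := ⟨n - 2, by omega⟩
  simp only [Nat.add_sub_cancel, smul_eq_mul, show m + 2 - 1 = m + 1 by omega]
  field_simp
  ring

/-- A bounded compactly supported function which is differentiable away from the origin, with
integrable derivative, has derivative of integral zero (in dimension at least two). -/
lemma integral_fderiv_eq_zero_of_punctured (n : ℕ) (hn : 2 ≤ n) (w : Eu n → ℝ)
    (hw : HasCompactSupport w) (C : ℝ) (hC : ∀ x, |w x| ≤ C)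
    (hd : ∀ x, x ≠ 0 → DifferentiableAt ℝ w x) (v : Eu n)
    (hi : Integrable (fun x => fderiv ℝ w x v) volume) :
    ∫ x, fderiv ℝ w x v = 0 := by
  have : Nonempty (Fin n) := ⟨⟨0, by omega⟩⟩
  have hC0 : 0 ≤ C := (abs_nonneg _).trans (hC 0)
  let b : ContDiffBump (0 : Eu n) := ⟨1, 2, by norm_num, by norm_num⟩
  -- the derivative of the bump function decays
  obtain ⟨M, hM⟩ : ∃ M, ∀ y : Eu n, ‖(‖y‖ * fderiv ℝ b y v)‖ ≤ M := by
    have hb1 : ContDiff ℝ 1 b := b.contDiff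
    have hc : Continuous (fun y : Eu n => ‖y‖ * fderiv ℝ b y v) :=
      continuous_norm.mul ((hb1.continuous_fderiv one_ne_zero).clm_apply continuous_const)
    have hs : HasCompactSupport (fun y : Eu n => ‖y‖ * fderiv ℝ b y v) := by
      have h1 : HasCompactSupport (fderiv ℝ b) := b.hasCompactSupport.fderiv ℝ
      have h2 : HasCompactSupport (fun y => fderiv ℝ b y v) :=
        h1.comp_left (g := fun L : Eu n →L[ℝ] ℝ => L v) (by simp)
      exact h2.mul_left
    exact hs.exists_bound_of_continuous hc
  have hM0 : 0 ≤ M := (norm_nonneg _).trans (hM 0)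
  obtain ⟨R, hR⟩ : ∃ R, tsupport w ⊆ ball (0 : Eu n) R := by
    obtain ⟨R, hR⟩ := hw.isBounded.subset_ball (0 : Eu n)
    exact ⟨R, hR⟩
  let η : ℕ → Eu n → ℝ := fun k x => 1 - b (((k : ℝ) + 1) • x)
  have hηd : ∀ k, Differentiable ℝ (η k) := by
    intro k
    have hb1 : ContDiff ℝ 1 b := b.contDiff
    have : Differentiable ℝ b := hb1.differentiable one_ne_zero
    exact (differentiable_const _).sub (this.comp (by fun_prop : Differentiable ℝ (fun x : Eu n => ((k : ℝ) + 1) • x)))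
  have hηf : ∀ k x, fderiv ℝ (η k) x v = -(((k : ℝ) + 1) * fderiv ℝ b (((k : ℝ) + 1) • x) v) := by
    intro k x
    simp only [η]
    rw [fderiv_const_sub, fderiv_comp_smul]
    simp
  have hηb : ∀ k x, |η k x| ≤ 1 := by
    intro k x
    have h1 := b.nonneg (x := ((k : ℝ) + 1) • x)
    have h2 := b.le_one (x := ((k : ℝ) + 1) • x)
    simp only [η]
    rw [abs_le]; constructor <;> linarith
  have hη' : ∀ k x, x ≠ 0 → |fderiv ℝ (η k) x v| ≤ M * ‖x‖⁻¹ := by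
    intro k x hx
    have hk : (0 : ℝ) < (k : ℝ) + 1 := by positivity
    have hx' : 0 < ‖x‖ := norm_pos_iff.2 hx
    have := hM (((k : ℝ) + 1) • x)
    rw [norm_mul, norm_norm, norm_smul, Real.norm_of_nonneg hk.le, Real.norm_eq_abs] at this
    rw [hηf, abs_neg, abs_mul, abs_of_pos hk, ← div_eq_mul_inv, le_div_iff₀ hx']
    linarith
  have hη0 : ∀ k, η k =ᶠ[𝓝 0] 0 := by
    intro k
    have h : Tendsto (fun x : Eu n => ((k : ℝ) + 1) • x) (𝓝 0) (𝓝 0) := by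
      have : Continuous (fun x : Eu n => ((k : ℝ) + 1) • x) := by fun_prop
      simpa using this.tendsto 0
    filter_upwards [h.eventually b.eventuallyEq_one] with x hx
    simp [η, hx]
  have hη1 : ∀ x : Eu n, x ≠ 0 → ∀ᶠ k in atTop, η k =ᶠ[𝓝 x] 1 := by
    intro x hx
    have hx' : 0 < ‖x‖ := norm_pos_iff.2 hx
    obtain ⟨N, hN⟩ := exists_nat_gt (2 / (‖x‖ / 2))
    filter_upwards [eventually_ge_atTop N] with k hk
    have : ∀ᶠ y in 𝓝 x, ‖x‖ / 2 < ‖y‖ :=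
      continuous_norm.continuousAt.eventually (lt_mem_nhds (by linarith))
    filter_upwards [this] with y hy
    have hkN : (N : ℝ) ≤ k := by exact_mod_cast hk
    have : b (((k : ℝ) + 1) • y) = 0 := by
      apply b.zero_of_le_dist
      rw [dist_zero_right, norm_smul, Real.norm_of_nonneg (by positivity)]
      change (2 : ℝ) ≤ _
      rw [div_lt_iff₀ (by positivity)] at hN
      nlinarith
    simp [η, this]
  let W : ℕ → Eu n → ℝ := fun k x => η k x * w x
  have hWd : ∀ k, Differentiable ℝ (W k) := by
    intro k x
    by_cases hx : x = 0
    · subst hx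
      have : W k =ᶠ[𝓝 0] fun _ => 0 := by
        filter_upwards [hη0 k] with y hy
        simp [W, hy]
      exact this.differentiableAt_iff.2 (differentiableAt_const _)
    · exact (hηd k x).mul (hd x hx)
  have hWf : ∀ k x, x ≠ 0 →
      fderiv ℝ (W k) x v = η k x * fderiv ℝ w x v + w x * fderiv ℝ (η k) x v := by
    intro k x hx
    simp only [W]
    rw [fderiv_fun_mul (hηd k x) (hd x hx)]
    simp
  have hne : ∀ᵐ x : Eu n ∂volume, x ≠ 0 := by
    simp [ae_iff]
  let B : Eu n → ℝ := fun x => |fderiv ℝ w x v| + (ball (0 : Eu n) R).indicator (fun x => C * (M * ‖x‖⁻¹)) x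
  have hB : Integrable B volume := by
    refine hi.abs.add ?_
    rw [integrable_indicator_iff measurableSet_ball]
    exact ((inv_norm_integrableOn n hn R).const_mul M).const_mul C
  have hWB : ∀ k, ∀ᵐ x ∂volume, ‖fderiv ℝ (W k) x v‖ ≤ B x := by
    intro k
    filter_upwards [hne] with x hx
    rw [hWf k x hx, Real.norm_eq_abs]
    refine (abs_add_le _ _).trans (add_le_add ?_ ?_)
    · rw [abs_mul]
      exact mul_le_of_le_one_left (abs_nonneg _) (hηb k x)
    · by_cases hxR : x ∈ ball (0 : Eu n) R
      · rw [indicator_of_mem hxR, abs_mul]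
        exact mul_le_mul (hC x) (hη' k x hx) (abs_nonneg _) hC0
      · rw [indicator_of_notMem hxR]
        have : w x = 0 := image_eq_zero_of_notMem_tsupport (fun h => hxR (hR h))
        simp [this]
  have hWm : ∀ k, AEStronglyMeasurable (fun x => fderiv ℝ (W k) x v) volume := fun k =>
    (measurable_fderiv_apply_const ℝ (W k) v).aestronglyMeasurable
  have hW0 : ∀ k, ∫ x, fderiv ℝ (W k) x v = 0 := by
    intro k
    have hWi : Integrable (W k) volume :=
      (hWd k).continuous.integrable_of_hasCompactSupport hw.mul_left
    have hWi' : Integrable (fun x => fderiv ℝ (W k) x v) volume := hB.mono' (hWm k) (hWB k)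
    have := integral_mul_fderiv_eq_neg_fderiv_mul_of_integrable (μ := (volume : Measure (Eu n)))
      (f := fun _ : Eu n => (1 : ℝ)) (g := W k) (v := v) (by simp) (by simpa using hWi')
      (by simpa using hWi) (fun x _ => differentiableAt_const _) (fun x _ => hWd k x)
    simpa using this
  have hlim := tendsto_integral_of_dominated_convergence (μ := volume) B hWm hB hWB
    (f := fun x => fderiv ℝ w x v) (by
      filter_upwards [hne] with x hx
      refine tendsto_const_nhds.congr' ?_
      filter_upwards [hη1 x hx] with k hk
      have : W k =ᶠ[𝓝 x] w := by
        filter_upwards [hk] with y hy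
        simp [W, hy]
      rw [this.fderiv_eq])
  simp only [hW0] at hlim
  exact (tendsto_nhds_unique hlim tendsto_const_nhds)

/-- For `0 < r < 1` the logarithm `log (e / r)` is `1 - log r`. -/
lemma log_exp_div_eq {r : ℝ} (hr : 0 < r) : Real.log (Real.exp 1 / r) = 1 - Real.log r := by
  rw [Real.log_div (Real.exp_ne_zero _) hr.ne', Real.log_exp]

lemma one_le_log_exp_div {r : ℝ} (hr : 0 < r) (h1 : r ≤ 1) : 1 ≤ Real.log (Real.exp 1 / r) := by
  rw [log_exp_div_eq hr]
  have := Real.log_nonpos hr.le h1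
  linarith

lemma hasDerivAt_log_exp_div {r : ℝ} (hr : 0 < r) :
    HasDerivAt (fun s => Real.log (Real.exp 1 / s)) (-r⁻¹) r := by
  have h : HasDerivAt (fun s => 1 - Real.log s) (-r⁻¹) r :=
    (Real.hasDerivAt_log hr.ne').const_sub 1
  refine h.congr_of_eventuallyEq ?_
  filter_upwards [lt_mem_nhds hr] with s hs
  exact log_exp_div_eq hs

/-- The radial derivative of the example. -/
lemma hasDerivAt_profile (n : ℕ) (hn : 2 ≤ n) (ε : ℝ) (hε : 0 < ε) {r : ℝ} (hr : 0 < r)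
    (h1 : r < 1) :
    HasDerivAt (fun s : ℝ => 1 + s ^ (ε / ((n : ℝ) + ε)) *
        Real.log (Real.exp 1 / s) ^ (-(1 : ℝ) / n))
      (r ^ (-(n : ℝ) / ((n : ℝ) + ε)) *
        (ε / ((n : ℝ) + ε) * Real.log (Real.exp 1 / r) ^ (-(1 : ℝ) / n) +
          (1 / (n : ℝ)) * Real.log (Real.exp 1 / r) ^ (-((n : ℝ) + 1) / n))) r := by
  have hn0 : (0 : ℝ) < n := by exact_mod_cast (by omega : 0 < n)
  have hL := one_le_log_exp_div hr h1.le
  have hA := Real.hasDerivAt_rpow_const (x := r) (p := ε / ((n : ℝ) + ε)) (Or.inl hr.ne')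
  have hB := (hasDerivAt_log_exp_div hr).rpow_const (p := -(1 : ℝ) / n)
    (Or.inl (by positivity))
  have h := (hA.mul hB).const_add 1
  refine h.congr_deriv ?_
  have e1 : ε / ((n : ℝ) + ε) - 1 = -(n : ℝ) / ((n : ℝ) + ε) := by field_simp; ring
  have e2 : -(1 : ℝ) / n - 1 = -((n : ℝ) + 1) / n := by field_simp; ring
  have e3 : r ^ (ε / ((n : ℝ) + ε)) = r ^ (-(n : ℝ) / ((n : ℝ) + ε)) * r := by
    rw [← e1, Real.rpow_sub_one hr.ne']; field_simp
  rw [e1, e2, e3]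
  field_simp

/-- `r⁻¹ log^{-(1+β)}(e/r)` is integrable near zero. -/
lemma integrableOn_inv_mul_log (β : ℝ) (hβ : 0 < β) :
    IntegrableOn (fun r : ℝ => r⁻¹ * Real.log (Real.exp 1 / r) ^ (-β - 1)) (Ioo 0 1) volume := by
  have h := intervalIntegral.integrableOn_deriv_of_nonneg (a := 0) (b := 1)
    (g := fun r => β⁻¹ * Real.log (Real.exp 1 / r) ^ (-β))
    (g' := fun r : ℝ => r⁻¹ * Real.log (Real.exp 1 / r) ^ (-β - 1)) ?_ ?_ ?_
  · exact h.mono_set Ioo_subset_Ioc_self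
  · intro r hr
    rcases hr.1.eq_or_lt with h0 | h0
    · subst h0
      have ht : Tendsto (fun r => β⁻¹ * Real.log (Real.exp 1 / r) ^ (-β)) (𝓝[>] 0) (𝓝 (β⁻¹ * 0)) := by
        refine Tendsto.const_mul _ ((tendsto_rpow_neg_atTop hβ).comp ?_)
        refine Real.tendsto_log_atTop.comp ?_
        change Tendsto (fun r : ℝ => Real.exp 1 * r⁻¹) (𝓝[>] 0) atTop
        exact tendsto_inv_nhdsGT_zero.const_mul_atTop (Real.exp_pos 1)
      have hv : β⁻¹ * Real.log (Real.exp 1 / 0) ^ (-β) = β⁻¹ * 0 := by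
        simp [Real.zero_rpow (neg_ne_zero.2 hβ.ne')]
      have hc : ContinuousWithinAt (fun r => β⁻¹ * Real.log (Real.exp 1 / r) ^ (-β)) (Ioi 0) 0 := by
        change Tendsto _ _ (𝓝 (β⁻¹ * Real.log (Real.exp 1 / 0) ^ (-β)))
        rw [hv]
        exact ht
      rw [continuousWithinAt_Ioi_iff_Ici] at hc
      exact hc.mono Icc_subset_Ici_self
    · have hL := one_le_log_exp_div h0 hr.2
      exact (((hasDerivAt_log_exp_div h0).rpow_const (p := -β)
        (Or.inl (by positivity))).const_mul β⁻¹).continuousAt.continuousWithinAt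
  · intro r hr
    have hL := one_le_log_exp_div hr.1 hr.2.le
    refine (((hasDerivAt_log_exp_div hr.1).rpow_const (p := -β)
        (Or.inl (by positivity))).const_mul β⁻¹).congr_deriv ?_
    field_simp
  · intro r hr
    have hL := one_le_log_exp_div hr.1 hr.2.le
    have := hr.1
    positivity

/-- Integrability of `σ^{n+ε}`. -/
lemma sigma_integrable (n : ℕ) (hn : 2 ≤ n) (ε : ℝ) (hε : 0 < ε) :
    IntegrableOn (fun x : Eu n => (‖x‖ ^ (-(n : ℝ) / ((n : ℝ) + ε)) *
        (ε / ((n : ℝ) + ε) * Real.log (Real.exp 1 / ‖x‖) ^ (-(1 : ℝ) / n) +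
          (1 / (n : ℝ)) * Real.log (Real.exp 1 / ‖x‖) ^ (-((n : ℝ) + 1) / n))) ^ ((n : ℝ) + ε))
      (ball 0 1) volume := by
  have : Nonempty (Fin n) := ⟨⟨0, by omega⟩⟩
  have hn0 : (0 : ℝ) < n := by exact_mod_cast (by omega : 0 < n)
  rw [integrableOn_fun_norm_addHaar volume (f := fun r : ℝ => (r ^ (-(n : ℝ) / ((n : ℝ) + ε)) *
        (ε / ((n : ℝ) + ε) * Real.log (Real.exp 1 / r) ^ (-(1 : ℝ) / n) +
          (1 / (n : ℝ)) * Real.log (Real.exp 1 / r) ^ (-((n : ℝ) + 1) / n))) ^ ((n : ℝ) + ε))]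
  have hfin : Module.finrank ℝ (Eu n) = n := by simp
  rw [hfin]
  have hI := (integrableOn_inv_mul_log (ε / n) (by positivity)).const_mul
    ((ε / ((n : ℝ) + ε) + 1 / n) ^ ((n : ℝ) + ε))
  refine Integrable.mono' hI (Measurable.aestronglyMeasurable (by fun_prop)) ?_
  rw [ae_restrict_iff' measurableSet_Ioo]
  refine Eventually.of_forall fun r hr => ?_
  have hr0 := hr.1
  have hL := one_le_log_exp_div hr.1 hr.2.le
  set L := Real.log (Real.exp 1 / r) with hLdef
  have hL0 : 0 < L := by linarith
  rw [Real.norm_of_nonneg (by positivity), smul_eq_mul]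
  have h1 : L ^ (-((n : ℝ) + 1) / n) ≤ L ^ (-(1 : ℝ) / n) := by
    apply Real.rpow_le_rpow_of_exponent_le hL
    gcongr
    linarith
  have h2 : ε / ((n : ℝ) + ε) * L ^ (-(1 : ℝ) / n) + (1 / (n : ℝ)) * L ^ (-((n : ℝ) + 1) / n)
      ≤ (ε / ((n : ℝ) + ε) + 1 / n) * L ^ (-(1 : ℝ) / n) := by
    rw [add_mul]
    gcongr
  have h3 : (r ^ (-(n : ℝ) / ((n : ℝ) + ε))) ^ ((n : ℝ) + ε) = (r ^ n)⁻¹ := by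
    rw [← Real.rpow_mul hr0.le, div_mul_cancel₀ _ (by positivity), Real.rpow_neg hr0.le,
      Real.rpow_natCast]
  have h4 : (L ^ (-(1 : ℝ) / n)) ^ ((n : ℝ) + ε) = L ^ (-(ε / n) - 1) := by
    rw [← Real.rpow_mul hL0.le]
    congr 1
    field_simp
    ring
  have h5 : r ^ (n - 1) * (r ^ n)⁻¹ = r⁻¹ := by
    obtain ⟨m, rfl⟩ : ∃ m, n = m + 1 := ⟨n - 1, by omega⟩
    simp only [Nat.add_sub_cancel]
    field_simp
    ring
  rw [Real.mul_rpow (by positivity) (by positivity), h3, ← mul_assoc, h5, ← h4, mul_left_comm,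
    ← Real.mul_rpow (by positivity) (by positivity)]
  gcongr
/-- **Example (sharpness when the Sobolev exponent dominates, `γ_K > γ_ε`).**
Let `K ≥ 1` and `ε > 0` with `1/K > ε/(n+ε)`.  The map
`f(x) = (1 + |x|^{ε/(n+ε)} log^{-1/n}(e/|x|), 0, …, 0)` on `Bⁿ(0,1)`, together with
`σ = |∇f₁|` given by the displayed formula, lies in `W^{1,n}(Bⁿ(0,1), ℝⁿ)` with
`σ ∈ L^{n+ε}(Bⁿ(0,1))`, satisfies the heterogeneous distortion inequality
`|Df|ⁿ ≤ K J_f + σⁿ|f|ⁿ` a.e., and fails to be `γ`-Hölder continuous at the origin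
for every `γ > ε/(n+ε)`. -/
theorem sharpness_example_sobolev_dominant
    (n : ℕ) (hn : 2 ≤ n) (K ε : ℝ) (hK : 1 ≤ K) (hε : 0 < ε)
    (hKε : ε / ((n : ℝ) + ε) < 1 / K)
    (f : Eu n → Eu n)
    (hf : f = fun x =>
      (1 + ‖x‖ ^ (ε / ((n : ℝ) + ε)) *
          Real.log (Real.exp 1 / ‖x‖) ^ (-(1 : ℝ) / n)) •
        EuclideanSpace.single (⟨0, by omega⟩ : Fin n) (1 : ℝ))
    (σ : Eu n → ℝ)
    (hσ : σ = fun x =>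
      ‖x‖ ^ (-(n : ℝ) / ((n : ℝ) + ε)) *
        (ε / ((n : ℝ) + ε) * Real.log (Real.exp 1 / ‖x‖) ^ (-(1 : ℝ) / n) +
          (1 / (n : ℝ)) * Real.log (Real.exp 1 / ‖x‖) ^ (-((n : ℝ) + 1) / n))) :
    ∃ Df : Eu n → Eu n →L[ℝ] Eu n,
      IsWeakDerivOn (ball (0 : Eu n) 1) f Df ∧
      IntegrableOn (fun x => ‖f x‖ ^ (n : ℝ)) (ball (0 : Eu n) 1) volume ∧
      IntegrableOn (fun x => ‖Df x‖ ^ (n : ℝ)) (ball (0 : Eu n) 1) volume ∧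
      -- `σ = |∇f₁| = |Df|` a.e.
      (∀ᵐ x ∂volume, x ∈ ball (0 : Eu n) 1 → ‖Df x‖ = σ x) ∧
      IntegrableOn (fun x => σ x ^ ((n : ℝ) + ε)) (ball (0 : Eu n) 1) volume ∧
      HDistortion (ball (0 : Eu n) 1) f Df K σ ∧
      ∀ γ : ℝ, ε / ((n : ℝ) + ε) < γ →
        ¬ ∃ C : ℝ, ∀ x ∈ ball (0 : Eu n) 1, ‖f x - f 0‖ ≤ C * ‖x‖ ^ γ := by
  have : Nonempty (Fin n) := ⟨⟨0, by omega⟩⟩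
  have hn0 : (0 : ℝ) < n := by exact_mod_cast (by omega : 0 < n)
  set e : Eu n := EuclideanSpace.single (⟨0, by omega⟩ : Fin n) (1 : ℝ) with he
  have hen : ‖e‖ = 1 := by simp [he]
  let g : ℝ → ℝ := fun s => 1 + s ^ (ε / ((n : ℝ) + ε)) *
    Real.log (Real.exp 1 / s) ^ (-(1 : ℝ) / n)
  let U : Eu n → ℝ := fun x => g ‖x‖
  have hfU : ∀ x, f x = U x • e := fun x => by rw [hf]
  have hα : 0 < ε / ((n : ℝ) + ε) := by positivity
  have hU0 : U 0 = 1 := by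
    simp [U, g, Real.zero_rpow hα.ne']
  have hUm : Measurable U := by
    simp only [U, g]
    fun_prop
  -- basic facts on the punctured ball
  have hder : ∀ x : Eu n, x ≠ 0 → ‖x‖ < 1 → HasFDerivAt U (σ x • fderiv ℝ (fun y : Eu n => ‖y‖) x) x := by
    intro x hx hx1
    have hx0 : 0 < ‖x‖ := norm_pos_iff.2 hx
    have h1 : DifferentiableAt ℝ (fun y : Eu n => ‖y‖) x :=
      differentiableAt_id.norm ℝ hx
    have h2 := (hasDerivAt_profile n hn ε hε hx0 hx1).comp_hasFDerivAt x h1.hasFDerivAt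
    rw [hσ]
    exact h2
  have hσ0 : ∀ x : Eu n, x ≠ 0 → ‖x‖ < 1 → 0 ≤ σ x := by
    intro x hx hx1
    have hL := one_le_log_exp_div (norm_pos_iff.2 hx) hx1.le
    rw [hσ]
    positivity
  have hnorm : ∀ x : Eu n, x ≠ 0 → ‖x‖ < 1 → ‖fderiv ℝ U x‖ = σ x := by
    intro x hx hx1
    have h1 : DifferentiableAt ℝ (fun y : Eu n => ‖y‖) x :=
      differentiableAt_id.norm ℝ hx
    rw [(hder x hx hx1).fderiv, norm_smul, norm_fderiv_norm h1, mul_one,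
      Real.norm_of_nonneg (hσ0 x hx hx1)]
  have hUge : ∀ x : Eu n, ‖x‖ < 1 → 1 ≤ U x ∧ U x ≤ 2 := by
    intro x hx1
    by_cases hx : x = 0
    · rw [hx, hU0]; norm_num
    have hx0 : 0 < ‖x‖ := norm_pos_iff.2 hx
    have hL := one_le_log_exp_div hx0 hx1.le
    have a1 : ‖x‖ ^ (ε / ((n : ℝ) + ε)) ≤ 1 := Real.rpow_le_one hx0.le hx1.le hα.le
    have a2 : Real.log (Real.exp 1 / ‖x‖) ^ (-(1 : ℝ) / n) ≤ 1 :=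
      Real.rpow_le_one_of_one_le_of_nonpos hL (by rw [neg_div]; simp)
    have a3 : 0 ≤ ‖x‖ ^ (ε / ((n : ℝ) + ε)) := by positivity
    have a4 : 0 ≤ Real.log (Real.exp 1 / ‖x‖) ^ (-(1 : ℝ) / n) := by positivity
    simp only [U, g]
    constructor <;> nlinarith
  have hne : ∀ᵐ x : Eu n ∂volume, x ≠ 0 := by
    simp [ae_iff]
  let Df : Eu n → Eu n →L[ℝ] Eu n := fun x => (fderiv ℝ U x).smulRight e
  have hDfn : ∀ x, ‖Df x‖ = ‖fderiv ℝ U x‖ := by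
    intro x
    simp only [Df]
    rw [ContinuousLinearMap.norm_smulRight_apply, hen, mul_one]
  have hσi : IntegrableOn (fun x => σ x ^ ((n : ℝ) + ε)) (ball (0 : Eu n) 1) volume := by
    rw [hσ]
    exact sigma_integrable n hn ε hε
  have hDUm : Measurable (fun x => ‖fderiv ℝ U x‖) := (measurable_fderiv ℝ U).norm
  -- integrability of lower powers of the derivative
  have hpow : ∀ p : ℝ, 0 < p → p ≤ (n : ℝ) + ε →
      IntegrableOn (fun x => ‖fderiv ℝ U x‖ ^ p) (ball (0 : Eu n) 1) volume := by
    intro p hp0 hp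
    have h1 : IntegrableOn (fun x => 1 + σ x ^ ((n : ℝ) + ε)) (ball (0 : Eu n) 1) volume :=
      IntegrableOn.add (integrableOn_const measure_ball_lt_top.ne) hσi
    refine Integrable.mono' h1 (hDUm.pow_const p).aestronglyMeasurable ?_
    rw [ae_restrict_iff' measurableSet_ball]
    filter_upwards [hne] with x hx hxb
    have hx1 : ‖x‖ < 1 := by simpa using hxb
    rw [hnorm x hx hx1]
    have hs := hσ0 x hx hx1
    rw [Real.norm_of_nonneg (by positivity)]
    rcases le_total (σ x) 1 with h | h
    · have := Real.rpow_le_one hs h hp0.le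
      have h2 : 0 ≤ σ x ^ ((n : ℝ) + ε) := by positivity
      linarith
    · have := Real.rpow_le_rpow_of_exponent_le h hp
      linarith
  have hweak : ∀ φ : Eu n → ℝ, ContDiff ℝ (⊤ : ℕ∞) φ → HasCompactSupport φ →
      tsupport φ ⊆ ball (0 : Eu n) 1 → ∀ v : Eu n,
      Integrable (fun x => φ x * fderiv ℝ U x v) volume ∧
      Integrable (fun x => fderiv ℝ φ x v * U x) volume ∧
      ∫ x, (φ x * fderiv ℝ U x v + fderiv ℝ φ x v * U x) = 0 := by
    intro φ hφ hφc hφs v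
    have hφ1 : ContDiff ℝ 1 φ := hφ.of_le (by exact_mod_cast le_top)
    have hφd : Differentiable ℝ φ := hφ1.differentiable one_ne_zero
    obtain ⟨A, hA⟩ := hφc.exists_bound_of_continuous hφ.continuous
    have hA0 : 0 ≤ A := (norm_nonneg _).trans (hA 0)
    have hφv : Continuous (fun x => fderiv ℝ φ x v) :=
      (hφ1.continuous_fderiv one_ne_zero).clm_apply continuous_const
    have hz : ∀ x, x ∉ ball (0 : Eu n) 1 → φ x = 0 := fun x hx =>
      image_eq_zero_of_notMem_tsupport (fun h => hx (hφs h))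
    have hz' : ∀ x, x ∉ ball (0 : Eu n) 1 → fderiv ℝ φ x = 0 := fun x hx =>
      image_eq_zero_of_notMem_tsupport (fun h => hx (hφs (tsupport_fderiv_subset ℝ h)))
    have hDUv : IntegrableOn (fun x => fderiv ℝ U x v) (ball (0 : Eu n) 1) volume := by
      have h1 := (hpow 1 one_pos (by
        have : (2 : ℝ) ≤ n := by exact_mod_cast hn
        linarith)).mul_const ‖v‖
      refine Integrable.mono' h1 (measurable_fderiv_apply_const ℝ U v).aestronglyMeasurable ?_
      refine Eventually.of_forall fun x => ?_
      rw [Real.rpow_one]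
      exact (fderiv ℝ U x).le_opNorm v
    have i1 : Integrable (fun x => φ x * fderiv ℝ U x v) volume := by
      have h1 : IntegrableOn (fun x => φ x * fderiv ℝ U x v) (ball (0 : Eu n) 1) volume :=
        hDUv.bdd_mul (c := A) hφ.continuous.aestronglyMeasurable (Eventually.of_forall hA)
      rw [integrableOn_iff_integrable_of_support_subset] at h1
      · exact h1
      · intro x hx
        by_contra h
        exact hx (by simp [hz x h])
    have i2 : Integrable (fun x => fderiv ℝ φ x v * U x) volume := by
      have hc : HasCompactSupport (fun x => fderiv ℝ φ x v) :=
        (hφc.fderiv ℝ).comp_left (g := fun L : Eu n →L[ℝ] ℝ => L v) (by simp)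
      have h0 : Integrable (fun x => fderiv ℝ φ x v) volume :=
        hφv.integrable_of_hasCompactSupport hc
      refine Integrable.mono' (h0.norm.mul_const 2)
        (hφv.measurable.mul hUm).aestronglyMeasurable (Eventually.of_forall fun x => ?_)
      by_cases hx : x ∈ ball (0 : Eu n) 1
      · have := hUge x (by simpa using hx)
        rw [norm_mul, Real.norm_eq_abs (U x), abs_of_nonneg (by linarith)]
        gcongr
        exact this.2
      · simp [hz' x hx]
    refine ⟨i1, i2, ?_⟩
    let w : Eu n → ℝ := fun x => φ x * U x
    have hwd : ∀ x, x ≠ 0 → DifferentiableAt ℝ w x := by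
      intro x hx
      by_cases hxs : x ∈ tsupport φ
      · exact (hφd x).mul (hder x hx (by simpa using hφs hxs)).differentiableAt
      · have : w =ᶠ[𝓝 x] fun _ => 0 := by
          filter_upwards [notMem_tsupport_iff_eventuallyEq.1 hxs] with y hy
          simp [w, hy]
        exact this.differentiableAt_iff.2 (differentiableAt_const _)
    have hwf : ∀ x, x ≠ 0 →
        φ x * fderiv ℝ U x v + fderiv ℝ φ x v * U x = fderiv ℝ w x v := by
      intro x hx
      by_cases hxs : x ∈ tsupport φ
      · simp only [w]
        rw [fderiv_fun_mul (hφd x) (hder x hx (by simpa using hφs hxs)).differentiableAt]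
        simp [mul_comm]
      · have : w =ᶠ[𝓝 x] fun _ => 0 := by
          filter_upwards [notMem_tsupport_iff_eventuallyEq.1 hxs] with y hy
          simp [w, hy]
        rw [this.fderiv_eq, image_eq_zero_of_notMem_tsupport hxs,
          image_eq_zero_of_notMem_tsupport (fun h => hxs (tsupport_fderiv_subset ℝ h))]
        simp
    have hae : (fun x => φ x * fderiv ℝ U x v + fderiv ℝ φ x v * U x) =ᵐ[volume]
        fun x => fderiv ℝ w x v := by
      filter_upwards [hne] with x hx using hwf x hx
    rw [integral_congr_ae hae]
    refine integral_fderiv_eq_zero_of_punctured n hn w hφc.mul_right (A * 2) ?_ hwd v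
      ((i1.add i2).congr hae)
    intro x
    by_cases hx : x ∈ ball (0 : Eu n) 1
    · have := hUge x (by simpa using hx)
      simp only [w]
      rw [abs_mul, abs_of_nonneg (by linarith : 0 ≤ U x)]
      exact mul_le_mul (hA x) this.2 (by linarith) hA0
    · simp only [w, hz x hx, zero_mul, abs_zero]
      positivity
  have hdet : ∀ x, (Df x).det = 0 := by
    intro x
    change LinearMap.det ((Df x : Eu n →L[ℝ] Eu n) : Eu n →ₗ[ℝ] Eu n) = 0
    rw [LinearMap.det_eq_zero_iff_ker_ne_bot]
    intro hk
    have hr : Function.Injective (fderiv ℝ U x : Eu n →ₗ[ℝ] ℝ) := by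
      rw [← LinearMap.ker_eq_bot, LinearMap.ker_eq_bot']
      intro m hm
      rw [LinearMap.ker_eq_bot'] at hk
      apply hk
      have : fderiv ℝ U x m = 0 := hm
      simp [Df, this]
    have := LinearMap.finrank_le_finrank_of_injective hr
    simp at this
    omega
  refine ⟨Df, ?_, ?_, ?_, ?_, hσi, ?_, ?_⟩
  · intro φ hφ hφc hφs v
    obtain ⟨i1, i2, h⟩ := hweak φ hφ hφc hφs v
    rw [integral_add i1 i2] at h
    rw [setIntegral_eq_integral_of_forall_compl_eq_zero, setIntegral_eq_integral_of_forall_compl_eq_zero]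
    · have e1 : ∀ x, φ x • Df x v = (φ x * fderiv ℝ U x v) • e := by
        intro x; simp [Df, smul_smul]
      have e2 : ∀ x, fderiv ℝ φ x v • f x = (fderiv ℝ φ x v * U x) • e := by
        intro x; rw [hfU, smul_smul]
      simp only [e1, e2]
      rw [integral_smul_const, integral_smul_const, ← neg_smul]
      congr 1
      linarith
    · intro x hx
      rw [image_eq_zero_of_notMem_tsupport
        (fun h => hx (hφs (tsupport_fderiv_subset ℝ h)) : x ∉ tsupport (fderiv ℝ φ))]
      simp
    · intro x hx
      rw [image_eq_zero_of_notMem_tsupport (fun h => hx (hφs h) : x ∉ tsupport φ)]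
      simp
  · have h1 : IntegrableOn (fun _ : Eu n => (2 : ℝ) ^ (n : ℝ)) (ball (0 : Eu n) 1) volume :=
      integrableOn_const measure_ball_lt_top.ne
    have hfm : Measurable f := by
      have : f = fun x => U x • e := funext hfU
      rw [this]
      exact hUm.smul_const e
    refine Integrable.mono' h1 (hfm.norm.pow_const _).aestronglyMeasurable ?_
    rw [ae_restrict_iff' measurableSet_ball]
    refine Eventually.of_forall fun x hx => ?_
    have := hUge x (by simpa using hx)
    rw [Real.norm_of_nonneg (by positivity), hfU, norm_smul, hen, mul_one,
      Real.norm_of_nonneg (by linarith)]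
    exact Real.rpow_le_rpow (by linarith) this.2 hn0.le
  · simp only [hDfn]
    exact hpow n hn0 (by linarith)
  · filter_upwards [hne] with x hx hxb
    rw [hDfn]
    exact hnorm x hx (by simpa using hxb)
  · unfold HDistortion
    filter_upwards [hne] with x hx hxb
    have hx1 : ‖x‖ < 1 := by simpa using hxb
    have hs := hσ0 x hx hx1
    have hU := hUge x hx1
    rw [hDfn, hnorm x hx hx1, hdet, mul_zero, zero_add, hfU, norm_smul, hen, mul_one,
      Real.norm_of_nonneg (by linarith)]
    exact le_mul_of_one_le_right (by positivity) (Real.one_le_rpow hU.1 hn0.le)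
  · rintro γ hγ ⟨C, hC⟩
    set δ := γ - ε / ((n : ℝ) + ε) with hδ
    have hδ0 : 0 < δ := by linarith
    have key : ∀ r : ℝ, 0 < r → r < 1 → 1 ≤ |C| * (r ^ δ - Real.log r * r ^ δ) := by
      intro r hr hr1
      have hxn : ‖r • e‖ = r := by rw [norm_smul, hen, mul_one, Real.norm_of_nonneg hr.le]
      have h := hC (r • e) (by simpa [hxn] using hr1)
      have hL := one_le_log_exp_div hr hr1.le
      have hUr : U (r • e) - U 0 = r ^ (ε / ((n : ℝ) + ε)) *
          Real.log (Real.exp 1 / r) ^ (-(1 : ℝ) / n) := by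
        rw [hU0]; simp only [U, g, hxn]; ring
      rw [hfU, hfU, ← sub_smul, norm_smul, hen, mul_one, hUr, hxn,
        Real.norm_of_nonneg (by positivity)] at h
      have hlog := log_exp_div_eq hr
      set L := Real.log (Real.exp 1 / r) with hLd
      have hL0 : 0 < L := by linarith
      have h1 : L ^ (-(1 : ℝ)) ≤ L ^ (-(1 : ℝ) / n) := by
        apply Real.rpow_le_rpow_of_exponent_le hL
        rw [neg_div, neg_le_neg_iff, div_le_one hn0]
        exact_mod_cast (by omega : 1 ≤ n)
      rw [Real.rpow_neg_one] at h1
      have hg : r ^ γ = r ^ (ε / ((n : ℝ) + ε)) * r ^ δ := by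
        rw [← Real.rpow_add hr]; congr 1; rw [hδ]; ring
      have hra : 0 < r ^ (ε / ((n : ℝ) + ε)) := by positivity
      have hrd : 0 < r ^ δ := by positivity
      rw [hg, mul_left_comm] at h
      have h2 := le_of_mul_le_mul_left h hra
      have h3 : L⁻¹ ≤ |C| * r ^ δ := h1.trans (h2.trans (by gcongr; exact le_abs_self C))
      have h4 : 1 ≤ |C| * r ^ δ * L := by
        rwa [inv_le_iff_one_le_mul₀ hL0] at h3
      calc (1 : ℝ) ≤ |C| * r ^ δ * L := h4
        _ = _ := by rw [hlog]; ring
    have hlim : Tendsto (fun r : ℝ => |C| * (r ^ δ - Real.log r * r ^ δ)) (𝓝[>] 0)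
        (𝓝 (|C| * (0 - 0))) := by
      refine Tendsto.const_mul _ (Tendsto.sub ?_ (tendsto_log_mul_rpow_nhdsGT_zero hδ0))
      have h := (Real.continuousAt_rpow_const 0 δ (Or.inr hδ0.le)).tendsto
      rw [Real.zero_rpow hδ0.ne'] at h
      exact h.mono_left nhdsWithin_le_nhds
    have h1 : (1 : ℝ) ≤ |C| * (0 - 0) := by
      refine ge_of_tendsto hlim ?_
      filter_upwards [Ioo_mem_nhdsGT (zero_lt_one' ℝ)] with r hr using key r hr.1 hr.2
    simp at h1
    linarith
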